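/- For every real number x > −1, Σ_{k=0}^∞ 1/(k+1+x)² = Σ_{n=0}^∞ U(n,x) · R(n,x) · (1/64)^n, where U(n,x) = (1)_n³ (1+x)_n² / [(1/2)_n · (1/2 + x/2)_n² · (1 + x/2)_n²] and R(n,x) = (21n³ + 55n² + 47n + 13 + 2x³ + 13x²n + 28xn² + 11x² + 48xn + 20x) / (2(2n+x+1)²(2n+1)(2n+x+2)²). -/

import Mathlib

/-- The Pochhammer symbol (rising factorial): `poch a n = a (a+1) ⋯ (a+n-1)`. -/
noncomputable def poch (a : ℝ) (n : ℕ) : ℝ := (ascPochhammer ℝ n).eval a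

/-- `U(n,x)` of the accelerated series for `ζ(2,1+x)`. -/
noncomputable def Uacc2 (n : ℕ) (x : ℝ) : ℝ :=
  (poch 1 n) ^ 3 * (poch (1 + x) n) ^ 2 /
    (poch (1 / 2) n * (poch (1 / 2 + x / 2) n) ^ 2 * (poch (1 + x / 2) n) ^ 2)

/-- `R(n,x)` of the accelerated series for `ζ(2,1+x)`. -/
noncomputable def Racc2 (n : ℕ) (x : ℝ) : ℝ :=
  (21 * (n : ℝ) ^ 3 + 55 * (n : ℝ) ^ 2 + 47 * (n : ℝ) + 13 + 2 * x ^ 3 +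
      13 * x ^ 2 * (n : ℝ) + 28 * x * (n : ℝ) ^ 2 + 11 * x ^ 2 + 48 * x * (n : ℝ) +
      20 * x) /
    (2 * (2 * (n : ℝ) + x + 1) ^ 2 * (2 * (n : ℝ) + 1) * (2 * (n : ℝ) + x + 2) ^ 2)

open Filter Topology

theorem poch_zero (a : ℝ) : poch a 0 = 1 := by
  simp [poch]

theorem poch_succ (a : ℝ) (n : ℕ) : poch a (n + 1) = poch a n * (a + n) := by
  simp [poch, ascPochhammer_succ_eval]

theorem poch_pos {a : ℝ} (ha : 0 < a) (n : ℕ) : 0 < poch a n :=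
  ascPochhammer_pos n a ha

/-- The hypergeometric factor of the accelerated series, including the power of `1 / 64`. -/
noncomputable def hyperFactor (n : ℕ) (x : ℝ) : ℝ := Uacc2 n x * (1 / 64 : ℝ) ^ n

theorem hyperFactor_zero (x : ℝ) : hyperFactor 0 x = 1 := by
  simp [hyperFactor, Uacc2, poch_zero]

theorem hyperFactor_pos {x : ℝ} (hx : -1 < x) (n : ℕ) : 0 < hyperFactor n x := by
  have h₁ := poch_pos (one_pos) n
  have h₂ := poch_pos (show 0 < 1 + x by linarith) n
  have h₃ := poch_pos (show (0 : ℝ) < 1 / 2 by norm_num) n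
  have h₄ := poch_pos (show 0 < 1 / 2 + x / 2 by linarith) n
  have h₅ := poch_pos (show 0 < 1 + x / 2 by linarith) n
  unfold hyperFactor Uacc2
  positivity

theorem hyperFactor_succ {x : ℝ} (hx : -1 < x) (n : ℕ) :
    hyperFactor (n + 1) x = hyperFactor n x *
      (((n : ℝ) + 1) ^ 3 * (1 + x + n) ^ 2 /
        (2 * (2 * n + 1) * (1 + x + 2 * n) ^ 2 * (2 + x + 2 * n) ^ 2)) := by
  have hn : (0 : ℝ) ≤ n := n.cast_nonneg
  have h₃ := (poch_pos (show (0 : ℝ) < 1 / 2 by norm_num) n).ne'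
  have h₄ := (poch_pos (show 0 < 1 / 2 + x / 2 by linarith) n).ne'
  have h₅ := (poch_pos (show 0 < 1 + x / 2 by linarith) n).ne'
  have e₁ : (1 : ℝ) / 2 + n = (2 * n + 1) / 2 := by ring
  have e₂ : 1 / 2 + x / 2 + n = (1 + x + 2 * n) / 2 := by ring
  have e₃ : 1 + x / 2 + n = (2 + x + 2 * n) / 2 := by ring
  have p₁ : (2 * n + 1 : ℝ) ≠ 0 := by positivity
  have p₂ : 1 + x + 2 * n ≠ 0 := by linarith
  have p₃ : 2 + x + 2 * n ≠ 0 := by linarith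
  simp only [hyperFactor, Uacc2, poch_succ, e₁, e₂, e₃, pow_succ (1 / 64 : ℝ) n]
  generalize (1 / 64 : ℝ) ^ n = c
  field_simp
  ring

theorem hyperFactor_add_one {x : ℝ} (hx : -1 < x) (n : ℕ) :
    hyperFactor n (x + 1) = hyperFactor n x * ((1 + x + n) / (1 + x + 2 * n)) ^ 2 := by
  induction n with
  | zero =>
    have : 1 + x ≠ 0 := by linarith
    simp [hyperFactor_zero, this]
  | succ n ih =>
    have hn : (0 : ℝ) ≤ n := n.cast_nonneg
    rw [hyperFactor_succ (by linarith), hyperFactor_succ hx, ih]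
    have p₁ : (2 * n + 1 : ℝ) ≠ 0 := by positivity
    have p₂ : 1 + x + 2 * n ≠ 0 := by linarith
    have p₃ : 2 + x + 2 * n ≠ 0 := by linarith
    have p₄ : 3 + x + 2 * n ≠ 0 := by linarith
    have e₁ : 1 + (x + 1) + 2 * (n : ℝ) = 2 + x + 2 * n := by ring
    have e₂ : 2 + (x + 1) + 2 * (n : ℝ) = 3 + x + 2 * n := by ring
    have e₃ : 1 + x + 2 * ((n : ℝ) + 1) = 3 + x + 2 * n := by ring
    push_cast
    rw [e₁, e₂, e₃]
    field_simp
    ring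

theorem hyperFactor_le {x : ℝ} (hx : 0 ≤ x) (n : ℕ) : hyperFactor n x ≤ (1 / 2 : ℝ) ^ n := by
  induction n with
  | zero => simp [hyperFactor_zero]
  | succ n ih =>
    have hn : (0 : ℝ) ≤ n := n.cast_nonneg
    rw [hyperFactor_succ (by linarith), pow_succ]
    refine mul_le_mul ih ?_ (by positivity) (pow_nonneg (by norm_num) n)
    rw [div_le_div_iff₀ (by positivity) (by norm_num)]
    have h₁ : (1 + x + n) ^ 2 ≤ (1 + x + 2 * (n : ℝ)) ^ 2 :=
      pow_le_pow_left₀ (by positivity) (by linarith) 2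
    have h₂ : ((n : ℝ) + 1) ^ 2 ≤ (2 + x + 2 * n) ^ 2 :=
      pow_le_pow_left₀ (by positivity) (by linarith) 2
    have h₃ : (n : ℝ) + 1 ≤ 2 * n + 1 := by linarith
    calc ((n : ℝ) + 1) ^ 3 * (1 + x + n) ^ 2 * 2
        = 2 * (n + 1) * (1 + x + n) ^ 2 * (n + 1) ^ 2 := by ring
      _ ≤ 2 * (2 * n + 1) * (1 + x + 2 * n) ^ 2 * (2 + x + 2 * n) ^ 2 := by gcongr
      _ = _ := by ring

theorem Racc2_nonneg {x : ℝ} (hx : 0 ≤ x) (n : ℕ) : 0 ≤ Racc2 n x := by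
  unfold Racc2
  positivity

theorem Racc2_le {x : ℝ} (hx : 0 ≤ x) (n : ℕ) : Racc2 n x ≤ 14 / (1 + x) := by
  have hn : (0 : ℝ) ≤ n := n.cast_nonneg
  unfold Racc2
  calc _ ≤ 28 * (1 + x + n) ^ 3 / (2 * (1 + x + n) ^ 2 * 1 * (1 + x + n) ^ 2) := by
        refine div_le_div₀ (by positivity) ?_ (by positivity) ?_
        · rw [← sub_nonneg]
          ring_nf
          positivity
        · have h₁ : (1 + x + n) ^ 2 ≤ (2 * n + x + 1) ^ 2 :=
            pow_le_pow_left₀ (by positivity) (by linarith) 2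
          have h₂ : (1 + x + n) ^ 2 ≤ (2 * n + x + 2) ^ 2 :=
            pow_le_pow_left₀ (by positivity) (by linarith) 2
          have h₃ : (1 : ℝ) ≤ 2 * n + 1 := by linarith
          gcongr
    _ = 14 / (1 + x + n) := by
        field_simp
        ring
    _ ≤ 14 / (1 + x) := by
        exact div_le_div_of_nonneg_left (by norm_num) (by positivity) (by linarith)

/-- The certificate of the Wilf–Zeilberger telescoping `hyperFactor_mul_Racc2_sub`. -/
noncomputable def certificate (n : ℕ) (x : ℝ) : ℝ := hyperFactor n x / (1 + x + 2 * n) ^ 2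

theorem hyperFactor_mul_Racc2_sub {x : ℝ} (hx : -1 < x) (n : ℕ) :
    hyperFactor n x * Racc2 n x - hyperFactor n (x + 1) * Racc2 n (x + 1) =
      certificate n x - certificate (n + 1) x := by
  have hn : (0 : ℝ) ≤ n := n.cast_nonneg
  have p₁ : (n * 2 + 1 : ℝ) ≠ 0 := by positivity
  have p₂ : n * 2 + x + 1 ≠ 0 := by linarith
  have p₃ : n * 2 + x + 2 ≠ 0 := by linarith
  have p₄ : n * 2 + x + 3 ≠ 0 := by linarith
  have e₁ : 1 + x + 2 * (n : ℝ) = n * 2 + x + 1 := by ring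
  have e₂ : 2 + x + 2 * (n : ℝ) = n * 2 + x + 2 := by ring
  have e₃ : 1 + x + 2 * ((n : ℝ) + 1) = n * 2 + x + 3 := by ring
  have e₀ : 2 * (n : ℝ) = n * 2 := mul_comm _ _
  have e₄ : 2 * (n : ℝ) + (x + 1) + 1 = n * 2 + x + 2 := by ring
  have e₅ : 2 * (n : ℝ) + (x + 1) + 2 = n * 2 + x + 3 := by ring
  unfold certificate Racc2
  rw [hyperFactor_succ hx, hyperFactor_add_one hx]
  push_cast
  rw [e₁, e₂, e₃, e₄, e₅, e₀]
  generalize hyperFactor n x = c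
  field_simp
  ring

theorem certificate_le {x : ℝ} (hx : -1 < x) (n : ℕ) :
    certificate n x ≤ (1 / 2 : ℝ) ^ n / (1 + x) ^ 2 := by
  have hx' : 0 < 1 + x := by linarith
  have hn : (0 : ℝ) ≤ n := n.cast_nonneg
  have h : certificate n x = hyperFactor n (x + 1) / (1 + x + n) ^ 2 := by
    rw [hyperFactor_add_one hx, certificate]
    field_simp
  rw [h]
  exact div_le_div₀ (by positivity) (hyperFactor_le (by linarith) n) (by positivity)
    (pow_le_pow_left₀ hx'.le (by linarith) 2)

theorem hasSum_certificate_sub {x : ℝ} (hx : -1 < x) :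
    HasSum (fun n ↦ certificate n x - certificate (n + 1) x) (1 / (1 + x) ^ 2) := by
  have hs : Summable fun n ↦ certificate n x :=
    .of_nonneg_of_le (fun n ↦ div_nonneg (hyperFactor_pos hx n).le (sq_nonneg _))
      (certificate_le hx) (summable_geometric_two.div_const _)
  have h := hs.hasSum.sub ((hasSum_nat_add_iff' 1).2 hs.hasSum)
  simpa [certificate, hyperFactor_zero] using h

theorem hyperFactor_mul_Racc2_le {x : ℝ} (hx : 0 ≤ x) (n : ℕ) :
    hyperFactor n x * Racc2 n x ≤ (1 / 2 : ℝ) ^ n * (14 / (1 + x)) :=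
  mul_le_mul (hyperFactor_le hx n) (Racc2_le hx n) (Racc2_nonneg hx n) (by positivity)

theorem hyperFactor_mul_Racc2_nonneg {x : ℝ} (hx : 0 ≤ x) (n : ℕ) :
    0 ≤ hyperFactor n x * Racc2 n x :=
  mul_nonneg (hyperFactor_pos (by linarith) n).le (Racc2_nonneg hx n)

theorem summable_hyperFactor_mul_Racc2_of_nonneg {x : ℝ} (hx : 0 ≤ x) :
    Summable fun n ↦ hyperFactor n x * Racc2 n x :=
  .of_nonneg_of_le (hyperFactor_mul_Racc2_nonneg hx) (hyperFactor_mul_Racc2_le hx)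
    (summable_geometric_two.mul_right _)

theorem tsum_hyperFactor_mul_Racc2_le {x : ℝ} (hx : 0 ≤ x) :
    ∑' n, hyperFactor n x * Racc2 n x ≤ 28 / (1 + x) := by
  refine ((summable_hyperFactor_mul_Racc2_of_nonneg hx).tsum_le_tsum
    (hyperFactor_mul_Racc2_le hx) (summable_geometric_two.mul_right _)).trans_eq ?_
  rw [tsum_mul_right, tsum_geometric_two]
  ring

theorem tsum_hyperFactor_mul_Racc2_eq {x : ℝ} (hx : -1 < x) :
    ∑' n, hyperFactor n x * Racc2 n x =
      ∑' n, hyperFactor n (x + 1) * Racc2 n (x + 1) + 1 / (1 + x) ^ 2 := by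
  have h := (summable_hyperFactor_mul_Racc2_of_nonneg
    (show 0 ≤ x + 1 by linarith)).hasSum.add (hasSum_certificate_sub hx)
  rw [← h.tsum_eq]
  refine tsum_congr fun n ↦ ?_
  rw [← hyperFactor_mul_Racc2_sub hx]
  ring

theorem tsum_hyperFactor_mul_Racc2_eq_sum_range {x : ℝ} (hx : -1 < x) (m : ℕ) :
    ∑' n, hyperFactor n x * Racc2 n x =
      ∑' n, hyperFactor n (x + m) * Racc2 n (x + m) +
        ∑ k ∈ Finset.range m, 1 / ((k : ℝ) + 1 + x) ^ 2 := by
  induction m with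
  | zero => simp
  | succ m ih =>
    have hm : (0 : ℝ) ≤ m := m.cast_nonneg
    rw [ih, tsum_hyperFactor_mul_Racc2_eq (by linarith), Finset.sum_range_succ]
    push_cast
    rw [show x + ((m : ℝ) + 1) = x + m + 1 by ring, show (m : ℝ) + 1 + x = 1 + (x + m) by ring]
    ring

theorem tendsto_tsum_hyperFactor_mul_Racc2 {x : ℝ} (hx : -1 < x) :
    Tendsto (fun m : ℕ ↦ ∑' n, hyperFactor n (x + m) * Racc2 n (x + m)) atTop (𝓝 0) := by
  have hlim : Tendsto (fun m : ℕ ↦ 28 / (1 + (x + m))) atTop (𝓝 0) :=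
    (tendsto_atTop_add_const_left _ 1
      (tendsto_atTop_add_const_left _ x tendsto_natCast_atTop_atTop)).const_div_atTop 28
  have hnonneg : ∀ m : ℕ, 1 ≤ m → 0 ≤ x + m := fun m hm ↦ by
    have : (1 : ℝ) ≤ m := by exact_mod_cast hm
    linarith
  refine squeeze_zero' ?_ ?_ hlim
  · filter_upwards [eventually_ge_atTop 1] with m hm
    exact tsum_nonneg (hyperFactor_mul_Racc2_nonneg (hnonneg m hm))
  · filter_upwards [eventually_ge_atTop 1] with m hm
    exact tsum_hyperFactor_mul_Racc2_le (hnonneg m hm)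

theorem zeta2_accelerated_formula (x : ℝ) (hx : x > -1) :
    ∑' k : ℕ, 1 / ((k : ℝ) + 1 + x) ^ 2 =
      ∑' n : ℕ, Uacc2 n x * Racc2 n x * (1 / 64 : ℝ) ^ n := by
  have hterm : ∀ n, Uacc2 n x * Racc2 n x * (1 / 64 : ℝ) ^ n = hyperFactor n x * Racc2 n x :=
    fun n ↦ by rw [hyperFactor]; ring
  simp_rw [hterm]
  refine HasSum.tsum_eq ((hasSum_iff_tendsto_nat_of_nonneg (fun k ↦ by positivity) _).2 ?_)
  have h := (tendsto_tsum_hyperFactor_mul_Racc2 hx).const_sub (∑' n, hyperFactor n x * Racc2 n x)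
  rw [sub_zero] at h
  refine h.congr fun m ↦ ?_
  rw [sub_eq_iff_eq_add', ← tsum_hyperFactor_mul_Racc2_eq_sum_range hx m]
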